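/- Let G be a Garside group of finite type, x ∈ G, z ∈ SC(x), y = 𝔰^k(z) for a positive integer k, and let s, t ∈ G with 1 ⪯ s ⪯ t. Then the k-fold pullbacks at y satisfy s_{(k)} ⪯ t_{(k)}. -/

import Mathlib

/-- A Garside structure of finite type on a group `G`: a submonoid `P` of positive
elements with `P ∩ P⁻¹ = {1}`, such that the prefix order `a ⪯ b ↔ a⁻¹ * b ∈ P` is a
lattice order (with meet `wedge` and join `vee`), together with a Garside element `Δ ∈ P`
whose set of prefixes (the simple elements) is finite and generates `G`, satisfying
`Δ⁻¹ P Δ = P`, and such that every nontrivial positive element has a finite norm. -/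
structure GarsideStructure (G : Type*) [Group G] where
  P : Set G
  one_mem : (1 : G) ∈ P
  mul_mem : ∀ {a b : G}, a ∈ P → b ∈ P → a * b ∈ P
  eq_one_of_mem_of_inv_mem : ∀ a : G, a ∈ P → a⁻¹ ∈ P → a = 1
  wedge : G → G → G
  vee : G → G → G
  wedge_le_left : ∀ a b : G, (wedge a b)⁻¹ * a ∈ P
  wedge_le_right : ∀ a b : G, (wedge a b)⁻¹ * b ∈ P
  le_wedge : ∀ a b c : G, c⁻¹ * a ∈ P → c⁻¹ * b ∈ P → c⁻¹ * wedge a b ∈ P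
  le_vee_left : ∀ a b : G, a⁻¹ * vee a b ∈ P
  le_vee_right : ∀ a b : G, b⁻¹ * vee a b ∈ P
  vee_le : ∀ a b c : G, a⁻¹ * c ∈ P → b⁻¹ * c ∈ P → (vee a b)⁻¹ * c ∈ P
  Δ : G
  Δ_mem : Δ ∈ P
  simples_finite : {s : G | s ∈ P ∧ s⁻¹ * Δ ∈ P}.Finite
  simples_generate : Subgroup.closure {s : G | s ∈ P ∧ s⁻¹ * Δ ∈ P} = (⊤ : Subgroup G)
  conj_Delta_mem : ∀ a : G, a ∈ P → Δ⁻¹ * a * Δ ∈ P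
  mem_of_conj_Delta_mem : ∀ a : G, Δ⁻¹ * a * Δ ∈ P → a ∈ P
  norm_bounded : ∀ x : G, x ∈ P → x ≠ 1 →
    ∃ n : ℕ, ∀ L : List G, (∀ a ∈ L, a ∈ P ∧ a ≠ 1) → L.prod = x → L.length ≤ n

namespace GarsideStructure

variable {G : Type*} [Group G] (gs : GarsideStructure G)

/-- The prefix order: `a ⪯ b`. -/
def pre (a b : G) : Prop := a⁻¹ * b ∈ gs.P

/-- The suffix order: `a ≽ b` (i.e. `b` is a suffix of `a`). -/
def rdvd (a b : G) : Prop := a * b⁻¹ ∈ gs.P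

/-- Greatest common divisor with respect to the suffix order `≽` : `a ∧↰ b`. -/
def rwedge (a b : G) : G := (gs.vee a⁻¹ b⁻¹)⁻¹

/-- Least common multiple with respect to the suffix order `≽` : `a ∨↰ b`. -/
def rvee (a b : G) : G := (gs.wedge a⁻¹ b⁻¹)⁻¹

/-- Simple elements: positive prefixes of `Δ`. -/
def simple (s : G) : Prop := s ∈ gs.P ∧ s⁻¹ * gs.Δ ∈ gs.P

/-- Atoms: nontrivial positive elements which cannot be decomposed in `P`. -/
def atom (a : G) : Prop := a ∈ gs.P ∧ a ≠ 1 ∧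
  ∀ b c : G, b ∈ gs.P → c ∈ gs.P → a = b * c → b = 1 ∨ c = 1

/-- `inf x` : the maximal integer `p` with `Δ^p ⪯ x`. -/
noncomputable def ginf (x : G) : ℤ := sSup {p : ℤ | gs.pre (gs.Δ ^ p) x}

/-- `sup x` : the minimal integer `p` with `x ⪯ Δ^p`. -/
noncomputable def gsup (x : G) : ℤ := sInf {p : ℤ | gs.pre x (gs.Δ ^ p)}

/-- Canonical length `ℓ(x) = sup(x) - inf(x)`. -/
noncomputable def glen (x : G) : ℤ := gs.gsup x - gs.ginf x

/-- `‖x‖` : the maximal number of factors in a decomposition of `x` as a product of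
nontrivial positive elements. -/
noncomputable def gnorm (x : G) : ℕ :=
  sSup {k : ℕ | ∃ L : List G, (∀ a ∈ L, a ∈ gs.P ∧ a ≠ 1) ∧ L.prod = x ∧ L.length = k}

/-- The summit infimum `inf_s(x)` : the maximum of `inf` over the conjugacy class of `x`. -/
noncomputable def ginfs (x : G) : ℤ :=
  sSup {p : ℤ | ∃ y : G, (∃ α : G, α⁻¹ * x * α = y) ∧ p = gs.ginf y}

/-- The summit supremum `sup_s(x)` : the minimum of `sup` over the conjugacy class of `x`. -/
noncomputable def gsups (x : G) : ℤ :=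
  sInf {p : ℤ | ∃ y : G, (∃ α : G, α⁻¹ * x * α = y) ∧ p = gs.gsup y}

/-- The preferred prefix `𝔭(x) = (xΔ^{-inf x}) ∧ (x⁻¹Δ^{sup x}) ∧ Δ`. -/
noncomputable def pp (x : G) : G :=
  gs.wedge (gs.wedge (x * gs.Δ ^ (-gs.ginf x)) (x⁻¹ * gs.Δ ^ gs.gsup x)) gs.Δ

/-- Cyclic (left) sliding `𝔰(x) = 𝔭(x)⁻¹ x 𝔭(x)`. -/
noncomputable def sl (x : G) : G := (gs.pp x)⁻¹ * x * gs.pp x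

/-- The preferred suffix `𝔭↰(x) = (Δ^{-inf x}x) ∧↰ (Δ^{sup x}x⁻¹) ∧↰ Δ`. -/
noncomputable def ps (x : G) : G :=
  gs.rwedge (gs.rwedge (gs.Δ ^ (-gs.ginf x) * x) (gs.Δ ^ gs.gsup x * x⁻¹)) gs.Δ

/-- Cyclic right sliding `𝔰↰(x) = 𝔭↰(x) x 𝔭↰(x)⁻¹`. -/
noncomputable def rsl (x : G) : G := gs.ps x * x * (gs.ps x)⁻¹

/-- The super summit set `SSS(x)` : conjugates of `x` with maximal infimum and minimal
supremum among all conjugates of `x`. -/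
def SSS (x : G) : Set G :=
  {y | (∃ α : G, α⁻¹ * x * α = y) ∧
    ∀ z : G, (∃ α : G, α⁻¹ * x * α = z) → gs.ginf z ≤ gs.ginf y ∧ gs.gsup y ≤ gs.gsup z}

/-- The set of sliding circuits `SC(x)` : conjugates `y` of `x` with `𝔰^m(y) = y` for
some `m ≥ 1`. -/
noncomputable def SC (x : G) : Set G :=
  {y | (∃ α : G, α⁻¹ * x * α = y) ∧ ∃ m : ℕ, 1 ≤ m ∧ (gs.sl)^[m] y = y}

/-- The transport `α^{(1)} = 𝔭(x)⁻¹ α 𝔭(x^α)` of `α` at `x`. -/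
noncomputable def transport (x α : G) : G := (gs.pp x)⁻¹ * α * gs.pp (α⁻¹ * x * α)

/-- Iterated transport `α^{(i)}` of `α` at `x`: `α^{(0)} = α` and `α^{(i+1)}` is the
transport of `α^{(i)}` at `𝔰^i(x)`. -/
noncomputable def transportIter (x α : G) : ℕ → G
  | 0 => α
  | i + 1 => gs.transport ((gs.sl)^[i] x) (transportIter x α i)

/-- `c` is the `⪯`-minimal element `c_s(y)` satisfying `s ⪯ c` and `y^c ∈ SC(x)`. -/
def IsMinSCConj (x y s c : G) : Prop :=
  gs.pre s c ∧ (c⁻¹ * y * c) ∈ gs.SC x ∧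
    ∀ d : G, gs.pre s d → (d⁻¹ * y * d) ∈ gs.SC x → gs.pre c d

/-- `s` is an indecomposable conjugator starting at `u`: `u^s ∈ SC(x)`, `s ≠ 1` and there
is no `t` with `1 ≺ t ≺ s` and `u^t ∈ SC(x)`. -/
def IsIndecomposableConjugator (x u s : G) : Prop :=
  (s⁻¹ * u * s) ∈ gs.SC x ∧ s ≠ 1 ∧
    ¬ ∃ t : G, (gs.pre 1 t ∧ t ≠ 1) ∧ (gs.pre t s ∧ t ≠ s) ∧ (t⁻¹ * u * t) ∈ gs.SC x

/-- `u` is the pullback of `s` at `y = 𝔰(z)` : the `⪯`-minimal positive element with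
`z^u ∈ SSS(x)` and `s ⪯ u^{(1)}` (transport at `z`). -/
def IsPullback (x z s u : G) : Prop :=
  u ∈ gs.P ∧ (u⁻¹ * z * u) ∈ gs.SSS x ∧ gs.pre s (gs.transport z u) ∧
    ∀ u' : G, u' ∈ gs.P → (u'⁻¹ * z * u') ∈ gs.SSS x → gs.pre s (gs.transport z u') →
      gs.pre u u'

/-- The pullback `s_{(1)}` of `s` at `y = 𝔰(z)`. -/
noncomputable def pullbackOne (x z s : G) : G :=
  @Classical.epsilon G ⟨1⟩ (fun u => gs.IsPullback x z s u)

/-- The `k`-fold pullback `s_{(k)}` of `s` at `y = 𝔰^k(z)` (an element at `z`):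
`s_{(0)} = s` and `s_{(k+1)}` is the pullback at `𝔰(z)` (relative to `z`) of the `k`-fold
pullback of `s` at `𝔰^k(𝔰(z)) = y`. -/
noncomputable def pullbackIter (x : G) : G → ℕ → G → G
  | _, 0, s => s
  | z, k + 1, s => gs.pullbackOne x z (pullbackIter x (gs.sl z) k s)

end GarsideStructure

namespace GarsideStructure

variable {G : Type*} [Group G] (gs : GarsideStructure G)

theorem pre_refl (a : G) : gs.pre a a := by
  simpa [pre] using gs.one_mem

theorem pre_trans {a b c : G} (hab : gs.pre a b) (hbc : gs.pre b c) : gs.pre a c := by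
  have h := gs.mul_mem hab hbc
  rwa [show a⁻¹ * b * (b⁻¹ * c) = a⁻¹ * c by group] at h

theorem pre_iff_mul_left {c a b : G} : gs.pre (c * a) b ↔ gs.pre a (c⁻¹ * b) := by
  simp only [pre, mul_inv_rev, mul_assoc]

theorem pre_wedge_iff {a b c : G} : gs.pre c (gs.wedge a b) ↔ gs.pre c a ∧ gs.pre c b :=
  ⟨fun h => ⟨gs.pre_trans h (gs.wedge_le_left a b), gs.pre_trans h (gs.wedge_le_right a b)⟩,
    fun h => gs.le_wedge a b c h.1 h.2⟩

theorem Delta_conj_mem_iff (a : G) : gs.Δ⁻¹ * a * gs.Δ ∈ gs.P ↔ a ∈ gs.P :=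
  ⟨gs.mem_of_conj_Delta_mem a, gs.conj_Delta_mem a⟩

theorem Delta_zpow_conj_mem_iff (n : ℤ) (a : G) :
    gs.Δ ^ (-n) * a * gs.Δ ^ n ∈ gs.P ↔ a ∈ gs.P := by
  induction n generalizing a with
  | zero => simp
  | succ n ih =>
    rw [← ih a, ← gs.Delta_conj_mem_iff (gs.Δ ^ (-(n : ℤ)) * a * gs.Δ ^ (n : ℤ))]
    rw [show gs.Δ ^ (-((n : ℤ) + 1)) * a * gs.Δ ^ ((n : ℤ) + 1) =
      gs.Δ⁻¹ * (gs.Δ ^ (-(n : ℤ)) * a * gs.Δ ^ (n : ℤ)) * gs.Δ by group]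
  | pred n ih =>
    rw [← ih a, ← gs.Delta_conj_mem_iff (gs.Δ ^ (-(-(n : ℤ) - 1)) * a * gs.Δ ^ (-(n : ℤ) - 1))]
    rw [show gs.Δ⁻¹ * (gs.Δ ^ (-(-(n : ℤ) - 1)) * a * gs.Δ ^ (-(n : ℤ) - 1)) * gs.Δ =
      gs.Δ ^ (-(-(n : ℤ))) * a * gs.Δ ^ (-(n : ℤ)) by group]

theorem Delta_zpow_mul_mem_iff (n : ℤ) (a : G) :
    gs.Δ ^ n * a ∈ gs.P ↔ a * gs.Δ ^ n ∈ gs.P := by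
  rw [← gs.Delta_zpow_conj_mem_iff n (gs.Δ ^ n * a)]
  rw [show gs.Δ ^ (-n) * (gs.Δ ^ n * a) * gs.Δ ^ n = a * gs.Δ ^ n by group]

theorem pre_mul_Delta_zpow_iff (n : ℤ) (a b : G) :
    gs.pre (a * gs.Δ ^ n) (b * gs.Δ ^ n) ↔ gs.pre a b := by
  rw [pre, pre, ← gs.Delta_zpow_conj_mem_iff n (a⁻¹ * b)]
  rw [show (a * gs.Δ ^ n)⁻¹ * (b * gs.Δ ^ n) = gs.Δ ^ (-n) * (a⁻¹ * b) * gs.Δ ^ n by group]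

theorem pre_mul_Delta_zpow_neg_iff (n : ℤ) (a b : G) :
    gs.pre a (b * gs.Δ ^ (-n)) ↔ gs.pre (a * gs.Δ ^ n) b := by
  rw [← gs.pre_mul_Delta_zpow_iff n a]
  simp

theorem Delta_zpow_pre_conj_iff (p n : ℤ) (a : G) :
    gs.pre (gs.Δ ^ p) (gs.Δ ^ (-n) * a * gs.Δ ^ n) ↔ gs.pre (gs.Δ ^ p) a := by
  rw [pre, pre, ← gs.Delta_zpow_conj_mem_iff n ((gs.Δ ^ p)⁻¹ * a)]
  rw [show (gs.Δ ^ p)⁻¹ * (gs.Δ ^ (-n) * a * gs.Δ ^ n) =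
    gs.Δ ^ (-n) * ((gs.Δ ^ p)⁻¹ * a) * gs.Δ ^ n by group]

theorem conj_pre_Delta_zpow_iff (p n : ℤ) (a : G) :
    gs.pre (gs.Δ ^ (-n) * a * gs.Δ ^ n) (gs.Δ ^ p) ↔ gs.pre a (gs.Δ ^ p) := by
  rw [pre, pre, ← gs.Delta_zpow_conj_mem_iff n (a⁻¹ * gs.Δ ^ p)]
  rw [show (gs.Δ ^ (-n) * a * gs.Δ ^ n)⁻¹ * gs.Δ ^ p =
    gs.Δ ^ (-n) * (a⁻¹ * gs.Δ ^ p) * gs.Δ ^ n by group]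

theorem ginf_conj_Delta_zpow (n : ℤ) (a : G) :
    gs.ginf (gs.Δ ^ (-n) * a * gs.Δ ^ n) = gs.ginf a := by
  simp only [ginf, Delta_zpow_pre_conj_iff]

theorem gsup_conj_Delta_zpow (n : ℤ) (a : G) :
    gs.gsup (gs.Δ ^ (-n) * a * gs.Δ ^ n) = gs.gsup a := by
  simp only [gsup, conj_pre_Delta_zpow_iff]

theorem Delta_pow_mem (n : ℕ) : gs.Δ ^ n ∈ gs.P := by
  induction n with
  | zero => simpa using gs.one_mem
  | succ n ih => exact pow_succ gs.Δ n ▸ gs.mul_mem ih gs.Δ_mem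

theorem Delta_zpow_mem {n : ℤ} (hn : 0 ≤ n) : gs.Δ ^ n ∈ gs.P := by
  lift n to ℕ using hn
  simpa using gs.Delta_pow_mem n

theorem exists_Delta_zpow_bounds (a : G) :
    (∃ p : ℤ, gs.pre (gs.Δ ^ p) a) ∧ ∃ q : ℤ, gs.pre a (gs.Δ ^ q) := by
  have ha : a ∈ Subgroup.closure {s : G | s ∈ gs.P ∧ s⁻¹ * gs.Δ ∈ gs.P} := by
    rw [gs.simples_generate]
    exact Subgroup.mem_top a
  induction ha using Subgroup.closure_induction with
  | mem s hs => exact ⟨⟨0, by simpa [pre] using hs.1⟩, 1, by simpa [pre] using hs.2⟩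
  | one => exact ⟨⟨0, by simpa [pre] using gs.one_mem⟩, 0, by simpa [pre] using gs.one_mem⟩
  | mul a b _ _ iha ihb =>
    obtain ⟨⟨p, hp⟩, q, hq⟩ := iha
    obtain ⟨⟨p', hp'⟩, q', hq'⟩ := ihb
    refine ⟨⟨p + p', ?_⟩, q' + q, ?_⟩
    · have h := gs.mul_mem ((gs.Delta_zpow_conj_mem_iff p' _).mpr hp) hp'
      rwa [show gs.Δ ^ (-p') * ((gs.Δ ^ p)⁻¹ * a) * gs.Δ ^ p' * ((gs.Δ ^ p')⁻¹ * b) =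
        (gs.Δ ^ (p + p'))⁻¹ * (a * b) by group] at h
    · have h := gs.mul_mem hq' ((gs.Delta_zpow_conj_mem_iff q' _).mpr hq)
      rw [show b⁻¹ * gs.Δ ^ q' * (gs.Δ ^ (-q') * (a⁻¹ * gs.Δ ^ q) * gs.Δ ^ q') =
        (a * b)⁻¹ * gs.Δ ^ (q + q') by group] at h
      rwa [add_comm] at h
  | inv a _ iha =>
    obtain ⟨⟨p, hp⟩, q, hq⟩ := iha
    refine ⟨⟨-q, ?_⟩, -p, ?_⟩
    · rwa [pre, zpow_neg, inv_inv, Delta_zpow_mul_mem_iff]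
    · rw [pre, inv_inv, ← Delta_zpow_mul_mem_iff, zpow_neg]
      exact hp

theorem Delta_ne_one [Nontrivial G] : gs.Δ ≠ 1 := by
  intro h
  refine bot_ne_top (α := Subgroup G) ?_
  rw [← gs.simples_generate, eq_comm, Subgroup.closure_eq_bot_iff]
  rintro s ⟨hs, hs'⟩
  rw [h, mul_one] at hs'
  exact gs.eq_one_of_mem_of_inv_mem s hs hs'

theorem le_of_Delta_zpow_pre [Nontrivial G] {p q : ℤ} (h : gs.pre (gs.Δ ^ p) (gs.Δ ^ q)) :
    p ≤ q := by
  by_contra! hqp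
  refine gs.Delta_ne_one (gs.eq_one_of_mem_of_inv_mem _ gs.Δ_mem ?_)
  have h' := gs.mul_mem h (gs.Delta_zpow_mem (n := p - q - 1) (by omega))
  rw [← zpow_neg, ← zpow_add, ← zpow_add, show -p + q + (p - q - 1) = -1 by ring] at h'
  simpa using h'

theorem bddAbove_Delta_zpow_pre [Nontrivial G] (a : G) :
    BddAbove {p : ℤ | gs.pre (gs.Δ ^ p) a} := by
  obtain ⟨q, hq⟩ := (gs.exists_Delta_zpow_bounds a).2
  exact ⟨q, fun p hp => gs.le_of_Delta_zpow_pre (gs.pre_trans hp hq)⟩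

theorem bddBelow_pre_Delta_zpow [Nontrivial G] (a : G) :
    BddBelow {q : ℤ | gs.pre a (gs.Δ ^ q)} := by
  obtain ⟨p, hp⟩ := (gs.exists_Delta_zpow_bounds a).1
  exact ⟨p, fun q hq => gs.le_of_Delta_zpow_pre (gs.pre_trans hp hq)⟩

theorem Delta_zpow_ginf_pre [Nontrivial G] (a : G) : gs.pre (gs.Δ ^ gs.ginf a) a :=
  Int.csSup_mem (gs.exists_Delta_zpow_bounds a).1 (gs.bddAbove_Delta_zpow_pre a)

theorem pre_Delta_zpow_gsup [Nontrivial G] (a : G) : gs.pre a (gs.Δ ^ gs.gsup a) :=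
  Int.csInf_mem (gs.exists_Delta_zpow_bounds a).2 (gs.bddBelow_pre_Delta_zpow a)

theorem le_ginf [Nontrivial G] {p : ℤ} {a : G} (h : gs.pre (gs.Δ ^ p) a) : p ≤ gs.ginf a :=
  le_csSup (gs.bddAbove_Delta_zpow_pre a) h

theorem gsup_le [Nontrivial G] {q : ℤ} {a : G} (h : gs.pre a (gs.Δ ^ q)) : gs.gsup a ≤ q :=
  csInf_le (gs.bddBelow_pre_Delta_zpow a) h

theorem pp_mem [Nontrivial G] (a : G) : gs.pp a ∈ gs.P := by
  suffices h : gs.pre 1 (gs.pp a) by simpa [pre] using h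
  rw [pp, pre_wedge_iff, pre_wedge_iff]
  refine ⟨⟨?_, ?_⟩, by simpa [pre] using gs.Δ_mem⟩
  · rw [pre_mul_Delta_zpow_neg_iff, one_mul]
    exact gs.Delta_zpow_ginf_pre a
  · simpa [pre] using gs.pre_Delta_zpow_gsup a

theorem Delta_zpow_pre_conj_iff_pre_mul (p : ℤ) (z a : G) :
    gs.pre (gs.Δ ^ p) (a⁻¹ * z * a) ↔ gs.pre (z⁻¹ * (a * gs.Δ ^ p)) a := by
  rw [pre, pre, show (gs.Δ ^ p)⁻¹ * (a⁻¹ * z * a) = (z⁻¹ * (a * gs.Δ ^ p))⁻¹ * a by group]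

theorem conj_pre_Delta_zpow_iff_pre_mul (q : ℤ) (z a : G) :
    gs.pre (a⁻¹ * z * a) (gs.Δ ^ q) ↔ gs.pre (z * a * gs.Δ ^ (-q)) a := by
  rw [← gs.pre_mul_Delta_zpow_iff q (z * a * gs.Δ ^ (-q)), pre, pre]
  rw [show (a⁻¹ * z * a)⁻¹ * gs.Δ ^ q =
    (z * a * gs.Δ ^ (-q) * gs.Δ ^ q)⁻¹ * (a * gs.Δ ^ q) by group]

/-- The lower bounds of the transport of `a` at `z`, described in terms of lower bounds of `a`. -/
theorem pre_transport_iff (z a s : G) :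
    gs.pre s (gs.transport z a) ↔
      (gs.pre (z⁻¹ * (gs.pp z * s) * gs.Δ ^ gs.ginf (a⁻¹ * z * a)) a ∧
        gs.pre (z * (gs.pp z * s) * gs.Δ ^ (-gs.gsup (a⁻¹ * z * a))) a) ∧
      gs.pre (gs.pp z * s * gs.Δ ^ (-1 : ℤ)) a := by
  set w := a⁻¹ * z * a with hw
  have h : gs.pre s (gs.transport z a) ↔ gs.pre (a⁻¹ * (gs.pp z * s)) (gs.pp w) := by
    rw [pre, pre, transport, ← hw]
    rw [show s⁻¹ * ((gs.pp z)⁻¹ * a * gs.pp w) = (a⁻¹ * (gs.pp z * s))⁻¹ * gs.pp w by group]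
  rw [h]
  generalize gs.pp z * s = m
  rw [pp, pre_wedge_iff, pre_wedge_iff]
  refine and_congr (and_congr ?_ ?_) ?_
  · rw [pre_mul_Delta_zpow_neg_iff, pre, pre, hw]
    group
  · rw [← gs.pre_mul_Delta_zpow_neg_iff, neg_neg, pre, pre, hw]
    group
  · rw [← gs.pre_mul_Delta_zpow_neg_iff, neg_neg, zpow_one, pre, pre]
    group

theorem SSS_ginf_eq {x v w : G} (hv : v ∈ gs.SSS x) (hw : w ∈ gs.SSS x) :
    gs.ginf v = gs.ginf w :=
  le_antisymm (hw.2 v hv.1).1 (hv.2 w hw.1).1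

theorem SSS_gsup_eq {x v w : G} (hv : v ∈ gs.SSS x) (hw : w ∈ gs.SSS x) :
    gs.gsup v = gs.gsup w :=
  le_antisymm (hv.2 w hw.1).2 (hw.2 v hv.1).2

theorem conj_conj_of_conj {x z : G} (hz : ∃ α : G, α⁻¹ * x * α = z) (u : G) :
    ∃ α : G, α⁻¹ * x * α = u⁻¹ * z * u := by
  obtain ⟨α, rfl⟩ := hz
  exact ⟨α * u, by group⟩

theorem conj_wedge_mem_SSS [Nontrivial G] {x z a b : G} (hz : ∃ α : G, α⁻¹ * x * α = z)
    (ha : a⁻¹ * z * a ∈ gs.SSS x) (hb : b⁻¹ * z * b ∈ gs.SSS x) :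
    (gs.wedge a b)⁻¹ * z * gs.wedge a b ∈ gs.SSS x := by
  have hca : gs.pre (gs.wedge a b) a := gs.wedge_le_left a b
  have hcb : gs.pre (gs.wedge a b) b := gs.wedge_le_right a b
  have hinf : gs.ginf (a⁻¹ * z * a) ≤ gs.ginf ((gs.wedge a b)⁻¹ * z * gs.wedge a b) := by
    have key : ∀ d : G, gs.pre (gs.wedge a b) d → d⁻¹ * z * d ∈ gs.SSS x →
        gs.pre (z⁻¹ * (gs.wedge a b * gs.Δ ^ gs.ginf (a⁻¹ * z * a))) d := fun d hcd hd => by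
      have h := (gs.Delta_zpow_pre_conj_iff_pre_mul _ z d).mp (gs.Delta_zpow_ginf_pre _)
      rw [gs.SSS_ginf_eq hd ha] at h
      refine gs.pre_trans ?_ h
      rw [pre_iff_mul_left, inv_inv, mul_inv_cancel_left, pre_mul_Delta_zpow_iff]
      exact hcd
    refine gs.le_ginf ((gs.Delta_zpow_pre_conj_iff_pre_mul _ _ _).mpr ?_)
    exact gs.pre_wedge_iff.mpr ⟨key a hca ha, key b hcb hb⟩
  have hsup : gs.gsup ((gs.wedge a b)⁻¹ * z * gs.wedge a b) ≤ gs.gsup (a⁻¹ * z * a) := by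
    have key : ∀ d : G, gs.pre (gs.wedge a b) d → d⁻¹ * z * d ∈ gs.SSS x →
        gs.pre (z * gs.wedge a b * gs.Δ ^ (-gs.gsup (a⁻¹ * z * a))) d := fun d hcd hd => by
      have h := (gs.conj_pre_Delta_zpow_iff_pre_mul _ z d).mp (gs.pre_Delta_zpow_gsup _)
      rw [gs.SSS_gsup_eq hd ha] at h
      refine gs.pre_trans ?_ h
      rw [pre_mul_Delta_zpow_iff, pre_iff_mul_left, inv_mul_cancel_left]
      exact hcd
    refine gs.gsup_le ((gs.conj_pre_Delta_zpow_iff_pre_mul _ _ _).mpr ?_)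
    exact gs.pre_wedge_iff.mpr ⟨key a hca ha, key b hcb hb⟩
  refine ⟨conj_conj_of_conj hz _, fun w hw => ?_⟩
  exact ⟨(ha.2 w hw).1.trans hinf, hsup.trans (ha.2 w hw).2⟩

theorem pre_transport_wedge [Nontrivial G] {x z a b s : G} (hz : ∃ α : G, α⁻¹ * x * α = z)
    (ha : a⁻¹ * z * a ∈ gs.SSS x) (hb : b⁻¹ * z * b ∈ gs.SSS x)
    (hsa : gs.pre s (gs.transport z a)) (hsb : gs.pre s (gs.transport z b)) :
    gs.pre s (gs.transport z (gs.wedge a b)) := by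
  have hc := gs.conj_wedge_mem_SSS hz ha hb
  rw [pre_transport_iff] at hsa hsb ⊢
  rw [gs.SSS_ginf_eq ha hc, gs.SSS_gsup_eq ha hc] at hsa
  rw [gs.SSS_ginf_eq hb hc, gs.SSS_gsup_eq hb hc] at hsb
  exact ⟨⟨gs.pre_wedge_iff.mpr ⟨hsa.1.1, hsb.1.1⟩, gs.pre_wedge_iff.mpr ⟨hsa.1.2, hsb.1.2⟩⟩,
    gs.pre_wedge_iff.mpr ⟨hsa.2, hsb.2⟩⟩

theorem list_prod_mem {L : List G} (hL : ∀ a ∈ L, a ∈ gs.P) : L.prod ∈ gs.P := by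
  induction L with
  | nil => simpa using gs.one_mem
  | cons a L ih =>
    rw [List.prod_cons]
    exact gs.mul_mem (hL a (by simp)) (ih fun b hb => hL b (by simp [hb]))

theorem bddAbove_factorization_lengths {u : G} (hu : u ∈ gs.P) :
    BddAbove {k : ℕ | ∃ L : List G,
      (∀ a ∈ L, a ∈ gs.P ∧ a ≠ 1) ∧ L.prod = u ∧ L.length = k} := by
  by_cases h1 : u = 1
  · refine ⟨0, ?_⟩
    rintro _ ⟨L, hL, hprod, rfl⟩
    cases L with
    | nil => simp
    | cons a L =>
      rw [List.prod_cons, h1] at hprod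
      refine absurd (gs.eq_one_of_mem_of_inv_mem a (hL a (by simp)).1 ?_) (hL a (by simp)).2
      rw [inv_eq_of_mul_eq_one_right hprod]
      exact gs.list_prod_mem fun b hb => (hL b (by simp [hb])).1
  · obtain ⟨n, hn⟩ := gs.norm_bounded u hu h1
    refine ⟨n, ?_⟩
    rintro _ ⟨L, hL, hprod, rfl⟩
    exact hn L hL hprod

theorem gnorm_lt_gnorm {u v : G} (hv : v ∈ gs.P) (hvu : gs.pre v u) (hne : v ≠ u) :
    gs.gnorm v < gs.gnorm u := by
  have hu : u ∈ gs.P := by simpa using gs.mul_mem hv hvu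
  have hnonempty : {k : ℕ | ∃ L : List G,
      (∀ a ∈ L, a ∈ gs.P ∧ a ≠ 1) ∧ L.prod = v ∧ L.length = k}.Nonempty := by
    by_cases h1 : v = 1
    · exact ⟨0, [], by simp, by simp [h1], rfl⟩
    · exact ⟨1, [v], by simp [hv, h1], by simp, rfl⟩
  obtain ⟨L, hL, hprod, hlen⟩ := Nat.sSup_mem hnonempty (gs.bddAbove_factorization_lengths hv)
  refine Nat.lt_of_succ_le (le_csSup (gs.bddAbove_factorization_lengths hu)
    ⟨L ++ [v⁻¹ * u], ?_, by simp [hprod], by simp [hlen, gnorm]⟩)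
  intro a ha
  rcases List.mem_append.mp ha with ha | ha
  · exact hL a ha
  · rw [List.mem_singleton.mp ha]
    exact ⟨hvu, fun h => hne (inv_mul_eq_one.mp h)⟩

/-- A nonempty set of positive elements closed under meets has a least element. -/
theorem exists_least_of_wedge_mem {S : Set G} (hS : S.Nonempty) (hpos : S ⊆ gs.P)
    (hwedge : ∀ a ∈ S, ∀ b ∈ S, gs.wedge a b ∈ S) : ∃ u ∈ S, ∀ v ∈ S, gs.pre u v := by
  obtain ⟨u, hu, hmin⟩ := WellFounded.has_min (InvImage.wf gs.gnorm wellFounded_lt) S hS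
  refine ⟨u, hu, fun v hv => ?_⟩
  have huv := hwedge u hu v hv
  have heq : gs.wedge u v = u := by
    by_contra hne
    exact hmin _ huv (gs.gnorm_lt_gnorm (hpos huv) (gs.wedge_le_left u v) hne)
  have h : gs.pre (gs.wedge u v) v := gs.wedge_le_right u v
  rwa [heq] at h

theorem mul_Delta_zpow_mem {a : G} {p n : ℤ} (h : gs.pre (gs.Δ ^ p) a) (hn : -p ≤ n) :
    a * gs.Δ ^ n ∈ gs.P := by
  have h' := gs.mul_mem ((gs.Delta_zpow_conj_mem_iff (-p) _).mpr h)
    (gs.Delta_zpow_mem (n := p + n) (by omega))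
  rwa [show gs.Δ ^ (-(-p)) * ((gs.Δ ^ p)⁻¹ * a) * gs.Δ ^ (-p) * gs.Δ ^ (p + n) =
    a * gs.Δ ^ n by group] at h'

theorem exists_pre_transport [Nontrivial G] {x z : G} (hz : ∃ α : G, α⁻¹ * x * α = z)
    (hx : (gs.SSS x).Nonempty) (s : G) :
    ∃ u ∈ gs.P, u⁻¹ * z * u ∈ gs.SSS x ∧ gs.pre s (gs.transport z u) := by
  obtain ⟨y, hy⟩ := hx
  obtain ⟨α, hα⟩ : ∃ α : G, α⁻¹ * z * α = y := by
    obtain ⟨β, rfl⟩ := hy.1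
    obtain ⟨γ, rfl⟩ := hz
    exact ⟨γ⁻¹ * β, by group⟩
  obtain ⟨p, hp⟩ := (gs.exists_Delta_zpow_bounds α).1
  obtain ⟨q, hq⟩ := (gs.exists_Delta_zpow_bounds ((gs.pp z * s)⁻¹ * α)).1
  set n := max (-p) (-q)
  have hconj : (α * gs.Δ ^ n)⁻¹ * z * (α * gs.Δ ^ n) = gs.Δ ^ (-n) * y * gs.Δ ^ n := by
    rw [← hα]
    group
  refine ⟨α * gs.Δ ^ n, gs.mul_Delta_zpow_mem hp (le_max_left _ _), ?_, ?_⟩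
  · refine ⟨conj_conj_of_conj hz _, fun w hw => ?_⟩
    rw [hconj, ginf_conj_Delta_zpow, gsup_conj_Delta_zpow]
    exact hy.2 w hw
  · have h := gs.mul_mem (gs.mul_Delta_zpow_mem hq (le_max_right (-p) (-q)))
      (gs.pp_mem ((α * gs.Δ ^ n)⁻¹ * z * (α * gs.Δ ^ n)))
    rw [pre, transport]
    simpa only [mul_inv_rev, mul_assoc] using h

theorem exists_isPullback [Nontrivial G] {x z : G} (hz : ∃ α : G, α⁻¹ * x * α = z)
    (hx : (gs.SSS x).Nonempty) (s : G) : ∃ u, gs.IsPullback x z s u := by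
  obtain ⟨u, ⟨hu, huS, hus⟩, hmin⟩ := gs.exists_least_of_wedge_mem
    (S := {u | u ∈ gs.P ∧ u⁻¹ * z * u ∈ gs.SSS x ∧ gs.pre s (gs.transport z u)})
    (gs.exists_pre_transport hz hx s) (fun u hu => hu.1) (fun a ha b hb => by
      refine ⟨?_, gs.conj_wedge_mem_SSS hz ha.2.1 hb.2.1,
        gs.pre_transport_wedge hz ha.2.1 hb.2.1 ha.2.2 hb.2.2⟩
      have h := gs.le_wedge a b 1 (by simpa using ha.1) (by simpa using hb.1)
      simpa using h)
  exact ⟨u, hu, huS, hus, fun v hv hvS hvs => hmin v ⟨hv, hvS, hvs⟩⟩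

theorem pullbackOne_pre [Nontrivial G] {x z s t : G} (hz : ∃ α : G, α⁻¹ * x * α = z)
    (hst : gs.pre s t) : gs.pre (gs.pullbackOne x z s) (gs.pullbackOne x z t) := by
  by_cases hx : (gs.SSS x).Nonempty
  · have hs : gs.IsPullback x z s (gs.pullbackOne x z s) :=
      Classical.epsilon_spec (gs.exists_isPullback hz hx s)
    have ht : gs.IsPullback x z t (gs.pullbackOne x z t) :=
      Classical.epsilon_spec (gs.exists_isPullback hz hx t)
    exact hs.2.2.2 _ ht.1 ht.2.1 (gs.pre_trans hst ht.2.2.1)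
  · have h : gs.IsPullback x z s = gs.IsPullback x z t := by
      funext u
      exact propext ⟨fun hu => absurd ⟨_, hu.2.1⟩ hx, fun hu => absurd ⟨_, hu.2.1⟩ hx⟩
    rw [pullbackOne, pullbackOne, h]
    exact gs.pre_refl _

theorem pullbackIter_pre [Nontrivial G] {x z s t : G} (hz : ∃ α : G, α⁻¹ * x * α = z)
    (hst : gs.pre s t) (k : ℕ) :
    gs.pre (gs.pullbackIter x z k s) (gs.pullbackIter x z k t) := by
  induction k generalizing z with
  | zero => exact hst
  | succ k ih => exact gs.pullbackOne_pre hz (ih (conj_conj_of_conj hz _))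

end GarsideStructure

open GarsideStructure

variable {G : Type*} [Group G]

/-- Pullback is monotonic: if `1 ⪯ s ⪯ t` then `s_{(k)} ⪯ t_{(k)}`. -/
theorem pullback_monotonic (gs : GarsideStructure G) (x z s t : G)
    (hz : z ∈ gs.SC x) (k : ℕ) (hk : 0 < k)
    (hs : gs.pre 1 s) (hst : gs.pre s t) :
    gs.pre (gs.pullbackIter x z k s) (gs.pullbackIter x z k t) := by
  rcases subsingleton_or_nontrivial G with _ | _
  · rw [Subsingleton.elim (gs.pullbackIter x z k s) (gs.pullbackIter x z k t)]
    exact gs.pre_refl _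
  · exact gs.pullbackIter_pre hz.1 hst k
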